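/- With rotation systems of K₅ and the action of Aut(K₅) × C₂ (relabeling together with reversal) defined as follows, the total number of orbits of all 7776 rotation systems of K₅ is exactly 50. Moreover, every rotation system of K₅ has exactly 1, 3, or 5 faces, and the numbers of orbits with 5, 3, and 1 faces are 6, 31, and 13 respectively. -/

import Mathlib

/-- A rotation system of `K₅` assigns to each vertex a permutation of `Fin 5`. -/
abbrev K5RotSys := Fin 5 → Equiv.Perm (Fin 5)

/-- Each rotation fixes its vertex and is a single 4-cycle on the 4 neighbors. -/
def IsRotSysK5 (ρ : K5RotSys) : Prop :=
  ∀ y : Fin 5, (ρ y).IsCycle ∧ ρ y y = y ∧ (ρ y).support.card = 4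

/-- The face permutation on darts: `Φ (x, y) = (y, ρ_y x)`. -/
def facePermK5 (ρ : K5RotSys) : Fin 5 × Fin 5 → Fin 5 × Fin 5 :=
  fun d => (d.2, ρ d.2 d.1)

/-- Two darts lie on the same face. -/
def SameFace (ρ : K5RotSys) (d d' : Fin 5 × Fin 5) : Prop :=
  ∃ k : ℕ, (facePermK5 ρ)^[k] d = d'

/-- The face permutation has exactly `n` orbits on the 20 darts. -/
def HasFaces (ρ : K5RotSys) (n : ℕ) : Prop :=
  ∃ D : Fin n → Fin 5 × Fin 5,
    (∀ i, (D i).1 ≠ (D i).2) ∧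
    (∀ i j, i ≠ j → ¬ SameFace ρ (D i) (D j)) ∧
    ∀ d : Fin 5 × Fin 5, d.1 ≠ d.2 → ∃ i, SameFace ρ (D i) d

/-- Equivalence under `Aut(K₅) × C₂`: relabelling by a permutation `φ` of the
vertices, optionally composed with reversal of all rotations. -/
def EquivFullK5 (ρ ρ' : K5RotSys) : Prop :=
  ∃ φ : Equiv.Perm (Fin 5), ∃ r : Bool,
    ∀ y, ρ' (φ y) = φ * (if r then (ρ y)⁻¹ else ρ y) * φ⁻¹

/-- Equivalence under `Aut(K₅)` alone: relabelling by a permutation of the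
vertices. -/
def EquivAutK5 (ρ ρ' : K5RotSys) : Prop :=
  ∃ φ : Equiv.Perm (Fin 5), ∀ y, ρ' (φ y) = φ * ρ y * φ⁻¹

/-! ### Faces as cycles of the face permutation -/

/-- `facePermK5 ρ` as a permutation of `Fin 5 × Fin 5`. -/
def faceEquiv (ρ : K5RotSys) : Equiv.Perm (Fin 5 × Fin 5) where
  toFun := facePermK5 ρ
  invFun d := ((ρ d.1)⁻¹ d.2, d.1)
  left_inv d := by simp [facePermK5]
  right_inv d := by simp [facePermK5]

theorem faceEquiv_pow_apply (ρ : K5RotSys) (k : ℕ) (d : Fin 5 × Fin 5) :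
    (faceEquiv ρ ^ k) d = (facePermK5 ρ)^[k] d := by
  rw [← Equiv.Perm.iterate_eq_pow]
  rfl

theorem sameFace_iff_sameCycle {ρ : K5RotSys} {d d' : Fin 5 × Fin 5} :
    SameFace ρ d d' ↔ (faceEquiv ρ).SameCycle d d' := by
  simp only [SameFace, ← faceEquiv_pow_apply]
  refine ⟨fun ⟨k, hk⟩ => ⟨k, by simpa using hk⟩, fun h => ?_⟩
  obtain ⟨k, -, -, hk⟩ := h.exists_pow_eq
  exact ⟨k, hk⟩

theorem HasFaces.le {ρ : K5RotSys} {m n : ℕ} (hm : HasFaces ρ m) (hn : HasFaces ρ n) :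
    m ≤ n := by
  obtain ⟨D, hD, hdisj, -⟩ := hm
  obtain ⟨E, -, -, hE⟩ := hn
  simp only [sameFace_iff_sameCycle] at hdisj hE
  choose f hf using fun i => hE (D i) (hD i)
  have hinj : Function.Injective f := fun i j hij => by
    by_contra hne
    exact hdisj i j hne ((hf i).symm.trans (hij ▸ hf j))
  simpa using Fintype.card_le_of_injective f hinj

theorem HasFaces.unique {ρ : K5RotSys} {m n : ℕ} (hm : HasFaces ρ m) (hn : HasFaces ρ n) :
    m = n :=
  le_antisymm (hm.le hn) (hn.le hm)

theorem HasFaces.map {ρ ρ' : K5RotSys} {n : ℕ} (e : Equiv.Perm (Fin 5 × Fin 5))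
    (hdart : ∀ d, (e d).1 ≠ (e d).2 ↔ d.1 ≠ d.2)
    (hface : ∀ d d', SameFace ρ' (e d) (e d') ↔ SameFace ρ d d') (h : HasFaces ρ n) :
    HasFaces ρ' n := by
  obtain ⟨D, hD, hdisj, hcov⟩ := h
  refine ⟨fun i => e (D i), fun i => (hdart _).2 (hD i),
    fun i j hij => (hface _ _).not.2 (hdisj i j hij), fun d hd => ?_⟩
  obtain ⟨d, rfl⟩ := e.surjective d
  obtain ⟨i, hi⟩ := hcov d ((hdart d).1 hd)
  exact ⟨i, (hface _ _).2 hi⟩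

/-- The darts that come first, in the lexicographic order, on their face. -/
def faceRoots (ρ : K5RotSys) : Finset (Fin 5 × Fin 5) :=
  {d | d.1 ≠ d.2 ∧ ∀ k : Fin 27, finProdFinEquiv d ≤ finProdFinEquiv ((facePermK5 ρ)^[k] d)}

theorem mem_faceRoots {ρ : K5RotSys} {d : Fin 5 × Fin 5} :
    d ∈ faceRoots ρ ↔ d.1 ≠ d.2 ∧ ∀ d', SameFace ρ d d' →
      finProdFinEquiv d ≤ finProdFinEquiv d' := by
  simp only [faceRoots, Finset.mem_filter, Finset.mem_univ, true_and]
  refine and_congr_right fun _ => ⟨fun h d' hd' => ?_, fun h k => h _ ⟨k, rfl⟩⟩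
  obtain ⟨k, -, hk, rfl⟩ := (sameFace_iff_sameCycle.1 hd').exists_pow_eq
  have hcard := Finset.card_le_univ ((faceEquiv ρ).cycleOf d).support
  rw [Fintype.card_prod, Fintype.card_fin] at hcard
  rw [faceEquiv_pow_apply]
  exact h ⟨k, by omega⟩

theorem facePermK5_iterate_ne {ρ : K5RotSys} (hρ : IsRotSysK5 ρ) {d : Fin 5 × Fin 5}
    (hd : d.1 ≠ d.2) (k : ℕ) : ((facePermK5 ρ)^[k] d).1 ≠ ((facePermK5 ρ)^[k] d).2 := by
  induction k with
  | zero => exact hd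
  | succ k ih =>
    rw [Function.iterate_succ_apply']
    intro h
    apply ih
    simp only [facePermK5] at h
    exact (ρ _).injective (h.symm.trans (hρ _).2.1.symm)

theorem hasFaces_card_faceRoots {ρ : K5RotSys} (hρ : IsRotSysK5 ρ) :
    HasFaces ρ (faceRoots ρ).card := by
  refine ⟨fun i => ((faceRoots ρ).equivFin.symm i).1,
    fun i => (mem_faceRoots.1 ((faceRoots ρ).equivFin.symm i).2).1, fun i j hij h => ?_,
    fun d hd => ?_⟩
  · have hsymm := sameFace_iff_sameCycle.2 (sameFace_iff_sameCycle.1 h).symm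
    have hi := (mem_faceRoots.1 ((faceRoots ρ).equivFin.symm i).2).2 _ h
    have hj := (mem_faceRoots.1 ((faceRoots ρ).equivFin.symm j).2).2 _ hsymm
    exact hij ((faceRoots ρ).equivFin.symm.injective
      (Subtype.ext (finProdFinEquiv.injective (le_antisymm hi hj))))
  · obtain ⟨m, hm, hmin⟩ := Set.exists_min_image {d' | SameFace ρ d d'} finProdFinEquiv
      (Set.toFinite _) ⟨d, 0, rfl⟩
    have hm' : (faceEquiv ρ).SameCycle d m := sameFace_iff_sameCycle.1 hm
    have hroot : m ∈ faceRoots ρ := by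
      refine mem_faceRoots.2 ⟨?_, fun d' hd' => hmin d' ?_⟩
      · obtain ⟨k, rfl⟩ := hm
        exact facePermK5_iterate_ne hρ hd k
      · exact sameFace_iff_sameCycle.2 (hm'.trans (sameFace_iff_sameCycle.1 hd'))
    refine ⟨(faceRoots ρ).equivFin ⟨m, hroot⟩, ?_⟩
    simpa using sameFace_iff_sameCycle.2 hm'.symm

/-! ### The action of relabellings and reversal -/

/-- The relabelling of `ρ` by `φ`. -/
def relabel (φ : Equiv.Perm (Fin 5)) (ρ : K5RotSys) : K5RotSys :=
  fun y => φ * ρ (φ⁻¹ y) * φ⁻¹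

theorem relabel_one (ρ : K5RotSys) : relabel 1 ρ = ρ := by
  funext y
  simp [relabel]

theorem relabel_mul (φ ψ : Equiv.Perm (Fin 5)) (ρ : K5RotSys) :
    relabel (φ * ψ) ρ = relabel φ (relabel ψ ρ) := by
  funext y
  simp [relabel, mul_assoc]

theorem relabel_inv (φ : Equiv.Perm (Fin 5)) (ρ : K5RotSys) :
    relabel φ ρ⁻¹ = (relabel φ ρ)⁻¹ := by
  funext y
  simp [relabel, mul_assoc]

theorem equivFullK5_iff {ρ ρ' : K5RotSys} :
    EquivFullK5 ρ ρ' ↔ ∃ φ, ρ' = relabel φ ρ ∨ ρ' = relabel φ ρ⁻¹ := by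
  refine exists_congr fun φ => ?_
  have key (σ : K5RotSys) : ρ' = relabel φ σ ↔ ∀ y, ρ' (φ y) = φ * σ y * φ⁻¹ := by
    rw [funext_iff, ← φ.forall_congr_right]
    simp [relabel]
  simp [key]

theorem EquivFullK5.symm {ρ ρ' : K5RotSys} (h : EquivFullK5 ρ ρ') : EquivFullK5 ρ' ρ := by
  obtain ⟨φ, rfl | rfl⟩ := equivFullK5_iff.1 h <;>
    refine equivFullK5_iff.2 ⟨φ⁻¹, ?_⟩ <;>
    simp [← relabel_mul, relabel_one, ← relabel_inv]

theorem EquivFullK5.trans {ρ₁ ρ₂ ρ₃ : K5RotSys} (h : EquivFullK5 ρ₁ ρ₂)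
    (h' : EquivFullK5 ρ₂ ρ₃) : EquivFullK5 ρ₁ ρ₃ := by
  obtain ⟨φ, rfl | rfl⟩ := equivFullK5_iff.1 h <;>
    obtain ⟨ψ, rfl | rfl⟩ := equivFullK5_iff.1 h' <;>
    refine equivFullK5_iff.2 ⟨ψ * φ, ?_⟩ <;>
    simp [relabel_mul, relabel_inv]

theorem HasFaces.relabel {ρ : K5RotSys} {n : ℕ} (h : HasFaces ρ n) (φ : Equiv.Perm (Fin 5)) :
    HasFaces (relabel φ ρ) n := by
  refine h.map (Equiv.prodCongr φ φ) (by simp) fun d d' => ?_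
  have hconj : faceEquiv (_root_.relabel φ ρ) =
      Equiv.prodCongr φ φ * faceEquiv ρ * (Equiv.prodCongr φ φ)⁻¹ := by
    refine Equiv.ext fun ⟨x, y⟩ => Prod.ext ?_ rfl
    exact (φ.apply_symm_apply y).symm
  rw [sameFace_iff_sameCycle, sameFace_iff_sameCycle, hconj, Equiv.Perm.sameCycle_conj]
  simp only [Equiv.Perm.inv_def, Equiv.symm_apply_apply]

theorem HasFaces.inv {ρ : K5RotSys} {n : ℕ} (h : HasFaces ρ n) : HasFaces ρ⁻¹ n := by
  let e : Equiv.Perm (Fin 5 × Fin 5) := Equiv.prodComm _ _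
  refine h.map e (fun d => ne_comm) fun d d' => ?_
  have hconj : faceEquiv ρ⁻¹ = e * (faceEquiv ρ)⁻¹ * e⁻¹ := by
    ext1 d
    rfl
  rw [sameFace_iff_sameCycle, sameFace_iff_sameCycle, hconj, Equiv.Perm.sameCycle_conj]
  simp only [Equiv.Perm.inv_def e, Equiv.symm_apply_apply, Equiv.Perm.sameCycle_inv]

theorem HasFaces.of_equivFullK5 {ρ ρ' : K5RotSys} {n : ℕ} (h : HasFaces ρ n)
    (he : EquivFullK5 ρ ρ') : HasFaces ρ' n := by
  obtain ⟨φ, rfl | rfl⟩ := equivFullK5_iff.1 he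
  · exact h.relabel φ
  · exact h.inv.relabel φ

/-! ### Coding rotation systems by numbers below `6 ^ 5` -/

/-- The six cyclic orders of the nonzero elements of `Fin 5`, in mutually inverse pairs. -/
def cyclicOrder : Fin 6 → List (Fin 5) :=
  ![[1, 2, 3, 4], [4, 3, 2, 1], [1, 2, 4, 3], [3, 4, 2, 1], [1, 3, 2, 4], [4, 2, 3, 1]]

/-- The six possible rotations at the vertex `y`. -/
def vertexRotation (y : Fin 5) (d : Fin 6) : Equiv.Perm (Fin 5) :=
  ((cyclicOrder d).map (y + ·)).formPerm

theorem isCycle_vertexRotation (y : Fin 5) (d : Fin 6) : (vertexRotation y d).IsCycle :=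
  List.isCycle_formPerm (by revert y d; decide +kernel) (by revert y d; decide +kernel)

theorem vertexRotation_apply_self : ∀ y d, vertexRotation y d y = y := by decide +kernel

theorem card_support_vertexRotation : ∀ y d, (vertexRotation y d).support.card = 4 := by
  decide +kernel

theorem exists_eq_vertexRotation_of_pow : ∀ (y : Fin 5) (σ : Equiv.Perm (Fin 5)),
    σ y = y → σ ^ 2 ≠ 1 → σ ^ 4 = 1 → ∃ d, σ = vertexRotation y d := by
  decide +kernel

/-- The base-6 digits of `c`. -/
def digits (c : ℕ) (y : Fin 5) : Fin 6 := Fin.ofNat 6 (c / 6 ^ (y : ℕ))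

/-- The number with given base-6 digits. -/
def encode (f : Fin 5 → Fin 6) : ℕ :=
  f 0 + 6 * (f 1 + 6 * (f 2 + 6 * (f 3 + 6 * f 4)))

theorem digits_encode (f : Fin 5 → Fin 6) : digits (encode f) = f := by
  funext y
  ext
  simp only [digits, encode, Fin.val_ofNat]
  fin_cases y <;> simp <;> omega

theorem encode_lt (f : Fin 5 → Fin 6) : encode f < 7776 := by
  simp only [encode]
  omega

theorem encode_digits {c : ℕ} (hc : c < 7776) : encode (digits c) = c := by
  simp [encode, digits]
  omega

/-- The rotation system with code `c`. -/
def decode (c : ℕ) : K5RotSys := fun y => vertexRotation y (digits c y)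

theorem isRotSysK5_decode (c : ℕ) : IsRotSysK5 (decode c) := fun y =>
  ⟨isCycle_vertexRotation y _, vertexRotation_apply_self y _, card_support_vertexRotation y _⟩

theorem vertexRotation_injective : ∀ y, Function.Injective (vertexRotation y) := by
  unfold Function.Injective
  decide +kernel

theorem decode_inj {a b : ℕ} (ha : a < 7776) (hb : b < 7776) (h : decode a = decode b) :
    a = b := by
  rw [← encode_digits ha, ← encode_digits hb]
  exact congrArg encode (funext fun y => vertexRotation_injective y (congrFun h y))

theorem IsRotSysK5.exists_decode {ρ : K5RotSys} (hρ : IsRotSysK5 ρ) :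
    ∃ c < 7776, ρ = decode c := by
  have hrot (y) : ∃ d, ρ y = vertexRotation y d := by
    obtain ⟨hcyc, hfix, hcard⟩ := hρ y
    have hord : orderOf (ρ y) = 4 := hcyc.orderOf.trans hcard
    refine exists_eq_vertexRotation_of_pow y _ hfix (fun h => ?_) (hord ▸ pow_orderOf_eq_one _)
    have := Nat.le_of_dvd two_pos (orderOf_dvd_of_pow_eq_one h)
    omega
  choose f hf using hrot
  exact ⟨encode f, encode_lt f, funext fun y => by rw [decode, digits_encode, hf]⟩

/-- The operation on codes described by a table: the new digit at `z` is obtained from the old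
digit `d` at `(T z).1` as the decimal digit number `d`, from the right, of `(T z).2`. -/
def act (T : Fin 5 → Fin 5 × ℕ) (c : ℕ) : ℕ :=
  encode fun z => Fin.ofNat 6 ((T z).2 / 10 ^ (digits c (T z).1 : ℕ) % 10)

/-- The table `T` describes the relabelling by `g`. -/
abbrev IsRelabelTable (T : Fin 5 → Fin 5 × ℕ) (g : Equiv.Perm (Fin 5)) : Prop :=
  ∀ z, (T z).1 = g⁻¹ z ∧ ∀ d : Fin 6,
    vertexRotation z (Fin.ofNat 6 ((T z).2 / 10 ^ (d : ℕ) % 10)) =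
      g * vertexRotation (g⁻¹ z) d * g⁻¹

theorem IsRelabelTable.decode_iterate {T : Fin 5 → Fin 5 × ℕ} {g : Equiv.Perm (Fin 5)}
    (hT : IsRelabelTable T g) (n c : ℕ) :
    decode ((act T)^[n] c) = relabel (g ^ n) (decode c) := by
  induction n with
  | zero => exact (relabel_one _).symm
  | succ n ih =>
    rw [Function.iterate_succ_apply', pow_succ', relabel_mul, ← ih]
    funext z
    simp only [decode, act, digits_encode, relabel]
    rw [(hT z).2, (hT z).1]

theorem act_iterate_lt (T : Fin 5 → Fin 5 × ℕ) (n : ℕ) {c : ℕ} (hc : c < 7776) :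
    (act T)^[n] c < 7776 := by
  cases n with
  | zero => exact hc
  | succ n =>
    rw [Function.iterate_succ_apply']
    exact encode_lt _

/-- The table of the 5-cycle `x ↦ x + 1`. -/
def shiftTable : Fin 5 → Fin 5 × ℕ :=
  ![(4, 543210), (0, 543210), (1, 543210), (2, 543210), (3, 543210)]

/-- The table of the 4-cycle `x ↦ 2 * x`. -/
def doubleTable : Fin 5 → Fin 5 × ℕ :=
  ![(0, 13254), (3, 13254), (1, 13254), (4, 13254), (2, 13254)]

/-- The table of the 3-cycle `2 ↦ 3 ↦ 4 ↦ 2`. -/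
def rotateTable : Fin 5 → Fin 5 × ℕ :=
  ![(0, 15423), (1, 231045), (4, 452310), (2, 320145), (3, 14532)]

/-- The table of the transposition of `2` and `3`. -/
def swapTable : Fin 5 → Fin 5 × ℕ :=
  ![(0, 102354), (1, 450123), (3, 324510), (2, 235410), (4, 451032)]

/-- The table of the reversal. -/
def reverseTable : Fin 5 → Fin 5 × ℕ :=
  ![(0, 452301), (1, 452301), (2, 452301), (3, 452301), (4, 452301)]

theorem isRelabelTable_shift : IsRelabelTable shiftTable [0, 1, 2, 3, 4].formPerm := by
  decide +kernel

theorem isRelabelTable_double : IsRelabelTable doubleTable [1, 2, 4, 3].formPerm := by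
  decide +kernel

theorem isRelabelTable_rotate : IsRelabelTable rotateTable [2, 3, 4].formPerm := by
  decide +kernel

theorem isRelabelTable_swap : IsRelabelTable swapTable [2, 3].formPerm := by
  decide +kernel

theorem reverseTable_spec : ∀ z, (reverseTable z).1 = z ∧ ∀ d : Fin 6,
    vertexRotation z (Fin.ofNat 6 ((reverseTable z).2 / 10 ^ (d : ℕ) % 10)) =
      (vertexRotation z d)⁻¹ := by
  decide +kernel

theorem decode_act_reverseTable (c : ℕ) : decode (act reverseTable c) = (decode c)⁻¹ := by
  funext z
  simp only [decode, act, digits_encode, Pi.inv_apply]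
  rw [(reverseTable_spec z).2, (reverseTable_spec z).1]

theorem exists_eq_mul_pow : ∀ φ : Equiv.Perm (Fin 5),
    ∃ (p : Fin 5) (q : Fin 4) (k : Fin 3) (l : Fin 2),
      φ = [0, 1, 2, 3, 4].formPerm ^ (p : ℕ) * [1, 2, 4, 3].formPerm ^ (q : ℕ) *
        [2, 3, 4].formPerm ^ (k : ℕ) * [2, 3].formPerm ^ (l : ℕ) := by
  decide +kernel

/-! ### Orbits of codes -/

/-- The codes of the rotation systems equivalent to the one with code `c`, with repetitions. -/
def orbitCodes (c : ℕ) : List ℕ :=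
  ((((List.iterate (act reverseTable) c 2).flatMap
    (List.iterate (act swapTable) · 2)).flatMap
    (List.iterate (act rotateTable) · 3)).flatMap
    (List.iterate (act doubleTable) · 4)).flatMap
    (List.iterate (act shiftTable) · 5)

theorem mem_orbitCodes {b c : ℕ} : b ∈ orbitCodes c ↔
    ∃ p < 5, ∃ q < 4, ∃ k < 3, ∃ l < 2, ∃ r < 2, b = (act shiftTable)^[p]
      ((act doubleTable)^[q] ((act rotateTable)^[k] ((act swapTable)^[l]
        ((act reverseTable)^[r] c)))) := by
  simp only [orbitCodes, List.mem_flatMap, List.mem_iterate]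
  constructor
  · rintro ⟨_, ⟨_, ⟨_, ⟨_, ⟨r, hr, rfl⟩, l, hl, rfl⟩, k, hk, rfl⟩, q, hq, rfl⟩, p, hp, rfl⟩
    exact ⟨p, hp, q, hq, k, hk, l, hl, r, hr, rfl⟩
  · rintro ⟨p, hp, q, hq, k, hk, l, hl, r, hr, rfl⟩
    exact ⟨_, ⟨_, ⟨_, ⟨_, ⟨r, hr, rfl⟩, l, hl, rfl⟩, k, hk, rfl⟩, q, hq, rfl⟩, p, hp, rfl⟩

theorem decode_word (p q k l c : ℕ) :
    decode ((act shiftTable)^[p] ((act doubleTable)^[q] ((act rotateTable)^[k]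
      ((act swapTable)^[l] c)))) =
    relabel ([0, 1, 2, 3, 4].formPerm ^ p * [1, 2, 4, 3].formPerm ^ q *
      [2, 3, 4].formPerm ^ k * [2, 3].formPerm ^ l) (decode c) := by
  rw [isRelabelTable_shift.decode_iterate, isRelabelTable_double.decode_iterate,
    isRelabelTable_rotate.decode_iterate, isRelabelTable_swap.decode_iterate]
  simp only [relabel_mul]

theorem equivFullK5_decode_iff {b c : ℕ} (hb : b < 7776) (hc : c < 7776) :
    EquivFullK5 (decode c) (decode b) ↔ b ∈ orbitCodes c := by
  rw [equivFullK5_iff, mem_orbitCodes]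
  constructor
  · rintro ⟨φ, h⟩
    obtain ⟨p, q, k, l, rfl⟩ := exists_eq_mul_pow φ
    refine ⟨p, p.2, q, q.2, k, k.2, l, l.2, ?_⟩
    rcases h with h | h
    · refine ⟨0, by norm_num, decode_inj hb ?_ (h.trans (decode_word _ _ _ _ _).symm)⟩
      iterate 4 apply act_iterate_lt
      exact hc
    · rw [← decode_act_reverseTable] at h
      refine ⟨1, by norm_num, decode_inj hb ?_ (h.trans (decode_word _ _ _ _ _).symm)⟩
      iterate 5 apply act_iterate_lt
      exact hc
  · rintro ⟨p, -, q, -, k, -, l, -, r, hr, rfl⟩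
    rw [decode_word]
    obtain rfl | rfl : r = 0 ∨ r = 1 := by omega
    · exact ⟨_, Or.inl rfl⟩
    · exact ⟨_, Or.inr (congrArg _ (decode_act_reverseTable c))⟩

/-- The finite set of the members of `l`, as a bit mask. -/
def bitMask (l : List ℕ) : ℕ := l.foldr (fun c m => 2 ^ c ||| m) 0

theorem testBit_bitMask (l : List ℕ) (c : ℕ) : (bitMask l).testBit c = true ↔ c ∈ l := by
  induction l with
  | nil => simp [bitMask]
  | cons a l ih =>
    rw [bitMask, List.foldr_cons, ← bitMask, Nat.testBit_or, Bool.or_eq_true, ih,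
      Nat.testBit_two_pow, decide_eq_true_iff, List.mem_cons, eq_comm]

/-- The least codes of the 50 orbits: first those with 5 faces, then 3 faces, then 1 face. -/
def repCodes : List ℕ :=
  [37, 52, 172, 224, 236, 502,
    0, 1, 4, 5, 7, 8, 9, 15, 16, 20, 28, 35, 39, 40, 41, 46, 49, 51, 61, 64, 67, 70, 148, 149, 178,
    226, 244, 245, 251, 365, 466,
    2, 10, 11, 14, 17, 29, 45, 57, 65, 71, 155, 400, 460]

theorem lt_of_mem_repCodes : ∀ c ∈ repCodes, c < 7776 := by decide +kernel

theorem bitMask_orbitCodes_inter :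
    ∀ c ∈ repCodes, bitMask (orbitCodes c) &&& bitMask repCodes = 2 ^ c := by
  decide +kernel

theorem bitMask_orbitCodes_union :
    repCodes.foldr (fun c m => bitMask (orbitCodes c) ||| m) 0 = 2 ^ 7776 - 1 := by
  decide +kernel

theorem eq_of_mem_orbitCodes {b c : ℕ} (hb : b ∈ repCodes) (hc : c ∈ repCodes)
    (h : b ∈ orbitCodes c) : c = b := by
  have := congrArg (Nat.testBit · b) (bitMask_orbitCodes_inter c hc)
  simpa [Nat.testBit_and, (testBit_bitMask _ _).2 h, (testBit_bitMask _ _).2 hb,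
    Nat.testBit_two_pow] using this

theorem exists_mem_orbitCodes {b : ℕ} (hb : b < 7776) : ∃ c ∈ repCodes, b ∈ orbitCodes c := by
  have hfold (l : List ℕ) :
      (l.foldr (fun c m => bitMask (orbitCodes c) ||| m) 0).testBit b = true →
        ∃ c ∈ l, b ∈ orbitCodes c := by
    induction l with
    | nil => simp
    | cons a l ih =>
      rw [List.foldr_cons, Nat.testBit_or, Bool.or_eq_true, testBit_bitMask]
      rintro (h | h)
      · exact ⟨a, List.mem_cons_self, h⟩
      · obtain ⟨c, hc, h⟩ := ih h
        exact ⟨c, List.mem_cons_of_mem _ hc, h⟩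
  apply hfold
  rw [bitMask_orbitCodes_union, Nat.testBit_two_pow_sub_one, decide_eq_true_iff]
  exact hb

/-! ### The representatives -/

/-- A representative of the `i`-th orbit. -/
def rep (i : Fin 50) : K5RotSys := decode (repCodes.get i)

theorem isRotSysK5_rep (i : Fin 50) : IsRotSysK5 (rep i) := isRotSysK5_decode _

theorem existsUnique_rep {ρ : K5RotSys} (hρ : IsRotSysK5 ρ) : ∃! i, EquivFullK5 (rep i) ρ := by
  have hlt (i : Fin 50) : repCodes.get i < 7776 := lt_of_mem_repCodes _ (List.get_mem _ _)
  obtain ⟨b, hb, rfl⟩ := hρ.exists_decode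
  obtain ⟨c, hc, hbc⟩ := exists_mem_orbitCodes hb
  obtain ⟨i, rfl⟩ := List.get_of_mem hc
  have hi : EquivFullK5 (rep i) (decode b) := (equivFullK5_decode_iff hb (hlt i)).2 hbc
  refine ⟨i, hi, fun j hj => ?_⟩
  have hnodup : repCodes.Nodup := by decide +kernel
  refine hnodup.injective_get (eq_of_mem_orbitCodes (List.get_mem _ _) (List.get_mem _ _) ?_)
  exact (equivFullK5_decode_iff (hlt i) (hlt j)).1 (EquivFullK5.trans hj hi.symm)

/-- The number of faces of `rep i`. -/
def repFaces (i : Fin 50) : ℕ := if i < 6 then 5 else if i < 37 then 3 else 1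

theorem card_faceRoots_rep : ∀ i, (faceRoots (rep i)).card = repFaces i := by
  decide +kernel

theorem hasFaces_rep (i : Fin 50) : HasFaces (rep i) (repFaces i) :=
  card_faceRoots_rep i ▸ hasFaces_card_faceRoots (isRotSysK5_rep i)

theorem exists_reps_of_hasFaces {n m : ℕ} (e : Fin m → Fin 50) (he : Function.Injective e)
    (hface : ∀ i, repFaces (e i) = n) (hrange : ∀ j, repFaces j = n → ∃ i, e i = j) :
    ∃ reps : Fin m → K5RotSys, (∀ i, IsRotSysK5 (reps i) ∧ HasFaces (reps i) n) ∧
      ∀ ρ, IsRotSysK5 ρ → HasFaces ρ n → ∃! i, EquivFullK5 (reps i) ρ := by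
  refine ⟨rep ∘ e, fun i => ⟨isRotSysK5_rep _, hface i ▸ hasFaces_rep _⟩, fun ρ hρ hn => ?_⟩
  obtain ⟨j, hj, huniq⟩ := existsUnique_rep hρ
  obtain ⟨i, rfl⟩ := hrange j (((hasFaces_rep j).of_equivFullK5 hj).unique hn)
  exact ⟨i, hj, fun k hk => he (huniq _ hk)⟩

/-- The 7776 rotation systems of `K₅` fall into exactly 50 orbits under
`Aut(K₅) × C₂`; every rotation system has exactly 1, 3 or 5 faces; and the
numbers of orbits with 5, 3 and 1 faces are 6, 31 and 13 respectively. -/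
theorem K5_all_embeddings :
    (∃ reps : Fin 50 → K5RotSys,
      (∀ i, IsRotSysK5 (reps i)) ∧
      ∀ ρ, IsRotSysK5 ρ → ∃! i, EquivFullK5 (reps i) ρ) ∧
    (∀ ρ, IsRotSysK5 ρ → HasFaces ρ 1 ∨ HasFaces ρ 3 ∨ HasFaces ρ 5) ∧
    (∃ reps : Fin 6 → K5RotSys,
      (∀ i, IsRotSysK5 (reps i) ∧ HasFaces (reps i) 5) ∧
      ∀ ρ, IsRotSysK5 ρ → HasFaces ρ 5 → ∃! i, EquivFullK5 (reps i) ρ) ∧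
    (∃ reps : Fin 31 → K5RotSys,
      (∀ i, IsRotSysK5 (reps i) ∧ HasFaces (reps i) 3) ∧
      ∀ ρ, IsRotSysK5 ρ → HasFaces ρ 3 → ∃! i, EquivFullK5 (reps i) ρ) ∧
    (∃ reps : Fin 13 → K5RotSys,
      (∀ i, IsRotSysK5 (reps i) ∧ HasFaces (reps i) 1) ∧
      ∀ ρ, IsRotSysK5 ρ → HasFaces ρ 1 → ∃! i, EquivFullK5 (reps i) ρ) := by
  refine ⟨⟨rep, isRotSysK5_rep, fun ρ => existsUnique_rep⟩, fun ρ hρ => ?_, ?_, ?_, ?_⟩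
  · obtain ⟨i, hi, -⟩ := existsUnique_rep hρ
    have h := (hasFaces_rep i).of_equivFullK5 hi
    have hi : repFaces i = 1 ∨ repFaces i = 3 ∨ repFaces i = 5 := by
      simp only [repFaces]
      split_ifs <;> simp
    rcases hi with hi | hi | hi <;> rw [hi] at h <;> simp [h]
  · exact exists_reps_of_hasFaces (fun i => ⟨i, by omega⟩)
      (by unfold Function.Injective; decide +kernel) (by decide +kernel) (by decide +kernel)
  · exact exists_reps_of_hasFaces (fun i => ⟨6 + i, by omega⟩)
      (by unfold Function.Injective; decide +kernel) (by decide +kernel) (by decide +kernel)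
  · exact exists_reps_of_hasFaces (fun i => ⟨37 + i, by omega⟩)
      (by unfold Function.Injective; decide +kernel) (by decide +kernel) (by decide +kernel)
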